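/- There exists a finite tile set T (with a glue strength function taking values in {0,1}) such that there are infinitely many finite assemblies α over T with the following 'Garden of Eden' property: α is 2-stable, but for every location p ∈ dom α, the restriction of α to dom α \ {p} is not 2-stable; consequently, none of these assemblies can arise from any valid growth process at temperature 2 starting from a single tile. -/

import Mathlib

namespace ATAM

/-- A tile type: a glue label (a natural number, with `0` the null glue) on each
of its four sides (north, east, south, west). -/
structure TileType where
  north : ℕ
  east : ℕ
  south : ℕ
  west : ℕ
deriving DecidableEq

/-- An assembly: a partial function from ℤ² to tile types. -/
abbrev Assembly := ℤ × ℤ → Option TileType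

/-- The domain of an assembly. -/
def adom (α : Assembly) : Set (ℤ × ℤ) := {p | α p ≠ none}

/-- `α` is a subassembly of `β` (written `α ⊑ β` in the paper). -/
def Subassembly (α β : Assembly) : Prop := ∀ p t, α p = some t → β p = some t

/-- Place tile `t` at position `p`. -/
def place (α : Assembly) (p : ℤ × ℤ) (t : TileType) : Assembly :=
  fun q => if q = p then some t else α q

/-- Remove the tile (if any) at position `p`. -/
def unplace (α : Assembly) (p : ℤ × ℤ) : Assembly :=
  fun q => if q = p then none else α q

/-- Union of two assemblies (preferring the left one where both are defined). -/
def aunion (α β : Assembly) : Assembly := fun p => (α p).orElse fun _ => β p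

/-- Two positions are adjacent iff they are at Manhattan distance 1. -/
def Adjacent (p q : ℤ × ℤ) : Prop := (p.1 - q.1).natAbs + (p.2 - q.2).natAbs = 1

/-- The total strength with which a tile of type `t` placed at (empty) position
`p` would bind to the assembly `α` (glues on abutting sides must match). -/
def attachStrength (str : ℕ → ℕ) (α : Assembly) (p : ℤ × ℤ) (t : TileType) : ℕ :=
  (match α (p.1, p.2 + 1) with
    | some u => if t.north = u.south then str t.north else 0
    | none => 0) +
  (match α (p.1 + 1, p.2) with
    | some u => if t.east = u.west then str t.east else 0
    | none => 0) +
  (match α (p.1, p.2 - 1) with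
    | some u => if t.south = u.north then str t.south else 0
    | none => 0) +
  (match α (p.1 - 1, p.2) with
    | some u => if t.west = u.east then str t.west else 0
    | none => 0)

/-- The strength of the bond between the tiles of `α` at `p` and at `q`
(nonzero only when `q` is one of the four neighbors of `p` and the glue labels
on the abutting sides match). -/
def interactionStrength (str : ℕ → ℕ) (α : Assembly) (p q : ℤ × ℤ) : ℕ :=
  match α p, α q with
  | some t, some u =>
      if q = (p.1, p.2 + 1) then (if t.north = u.south then str t.north else 0)
      else if q = (p.1 + 1, p.2) then (if t.east = u.west then str t.east else 0)
      else if q = (p.1, p.2 - 1) then (if t.south = u.north then str t.south else 0)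
      else if q = (p.1 - 1, p.2) then (if t.west = u.east then str t.west else 0)
      else 0
  | _, _ => 0

/-- The total strength of the cut `(A, B)` of the binding graph of `α`
(each crossing bond is counted exactly once, since `interactionStrength` is
directional and the two matching glues have equal strength). -/
def cutStrength (str : ℕ → ℕ) (α : Assembly) (A B : Finset (ℤ × ℤ)) : ℕ :=
  ∑ p ∈ A, ∑ q ∈ B, interactionStrength str α p q

/-- `α` is `τ`-stable: every cut of its binding graph has strength at least `τ`. -/
def IsStable (str : ℕ → ℕ) (τ : ℕ) (α : Assembly) : Prop :=
  ∀ A B : Finset (ℤ × ℤ), (A : Set (ℤ × ℤ)) ∪ (B : Set (ℤ × ℤ)) = adom α →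
    Disjoint A B → A.Nonempty → B.Nonempty → τ ≤ cutStrength str α A B

/-- A tile assembly system (TAS): a finite tile set, a glue strength function,
a seed assembly and a temperature. -/
structure TAS where
  tiles : Finset TileType
  str : ℕ → ℕ
  seed : Assembly
  temp : ℕ

/-- Well-formedness of a TAS: the null glue has strength 0, the temperature is
at least 1, and the seed is finite, over the tile set, and `τ`-stable. -/
def WellFormed (𝒯 : TAS) : Prop :=
  𝒯.str 0 = 0 ∧ 1 ≤ 𝒯.temp ∧ (adom 𝒯.seed).Finite ∧
    (∀ p t, 𝒯.seed p = some t → t ∈ 𝒯.tiles) ∧ IsStable 𝒯.str 𝒯.temp 𝒯.seed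

/-- A single tile attachment step of `𝒯`. -/
def Step (𝒯 : TAS) (α β : Assembly) : Prop :=
  ∃ p t, t ∈ 𝒯.tiles ∧ α p = none ∧ 𝒯.temp ≤ attachStrength 𝒯.str α p t ∧ β = place α p t

/-- A (finite or infinite) assembly sequence of `𝒯`, presented as an ℕ-indexed
sequence that starts at the seed and in which each assembly is obtained from the
previous one by a single attachment (or is unchanged, to accommodate finite
sequences). -/
def IsSeq (𝒯 : TAS) (f : ℕ → Assembly) : Prop :=
  f 0 = 𝒯.seed ∧ ∀ n, Step 𝒯 (f n) (f (n + 1)) ∨ f (n + 1) = f n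

/-- `α` is producible in `𝒯`: it is the result (limit) of an assembly sequence. -/
def Producible (𝒯 : TAS) (α : Assembly) : Prop :=
  ∃ f : ℕ → Assembly, IsSeq 𝒯 f ∧ ∀ p t, α p = some t ↔ ∃ n, f n p = some t

/-- `β` is producible from `α` by the attachment of zero or more tiles
(`α →^𝒯 β`). -/
def ProducibleFrom (𝒯 : TAS) (α β : Assembly) : Prop :=
  Relation.ReflTransGen (Step 𝒯) α β

/-- `α` is terminal: no tile can attach to it. -/
def Terminal (𝒯 : TAS) (α : Assembly) : Prop :=
  ∀ p t, t ∈ 𝒯.tiles → α p = none → attachStrength 𝒯.str α p t < 𝒯.temp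

/-- `𝒯` self-assembles the shape `S`: every producible terminal assembly has
domain `S`, and there is at least one producible terminal assembly. -/
def SelfAssembles (𝒯 : TAS) (S : Set (ℤ × ℤ)) : Prop :=
  (∀ α, Producible 𝒯 α → Terminal 𝒯 α → adom α = S) ∧
    ∃ α, Producible 𝒯 α ∧ Terminal 𝒯 α

/-- `S ⊆ ℤ²` is connected w.r.t. adjacency at Manhattan distance 1. -/
def ConnectedIn (S : Set (ℤ × ℤ)) : Prop :=
  ∀ p ∈ S, ∀ q ∈ S, Relation.ReflTransGen (fun a b => a ∈ S ∧ b ∈ S ∧ Adjacent a b) p q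

end ATAM
namespace ATAM

/-- The domain of the ring of height 2 on the columns `0, …, N`. -/
noncomputable def ringDom (N : ℕ) : Finset (ℤ × ℤ) := Finset.Icc 0 (N : ℤ) ×ˢ Finset.Icc 0 1

/-- The tile of the ring at a position: horizontal glues along both rows, vertical glues only
in the first and in the last column. -/
def ringTile (N : ℕ) (p : ℤ × ℤ) : TileType where
  north := if p.2 = 0 ∧ (p.1 = 0 ∨ p.1 = N) then 1 else 0
  east := if p.1 < N then 1 else 0
  south := if p.2 = 1 ∧ (p.1 = 0 ∨ p.1 = N) then 1 else 0
  west := if 0 < p.1 then 1 else 0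

/-- The ring of height 2 on the columns `0, …, N`; its binding graph is a cycle. -/
noncomputable def ring (N : ℕ) : Assembly := fun p =>
  if p ∈ ringDom N then some (ringTile N p) else none

/-- The counterclockwise successor of a position of the ring. -/
def ringNext (N : ℕ) (p : ℤ × ℤ) : ℤ × ℤ :=
  if p.2 = 0 then (if p.1 < N then (p.1 + 1, 0) else (p.1, 1))
  else (if 0 < p.1 then (p.1 - 1, 1) else (p.1, 0))

/-- The tile types that occur in rings. -/
def ringTiles : Finset TileType :=
  {⟨1, 1, 0, 0⟩, ⟨1, 0, 0, 1⟩, ⟨0, 1, 1, 0⟩, ⟨0, 0, 1, 1⟩, ⟨0, 1, 0, 1⟩}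

/-- The strength function giving every non-null glue strength 1. -/
def unitStrength (g : ℕ) : ℕ := min g 1

lemma unitStrength_le_one (g : ℕ) : unitStrength g ≤ 1 := min_le_right _ _

lemma mem_ringDom {N : ℕ} {x y : ℤ} :
    (x, y) ∈ ringDom N ↔ (0 ≤ x ∧ x ≤ N) ∧ 0 ≤ y ∧ y ≤ 1 := by
  simp [ringDom]

lemma adom_ring (N : ℕ) : adom (ring N) = ringDom N := by
  ext p
  simp [adom, ring]

lemma ringTile_mem_ringTiles {N : ℕ} (hN : 1 ≤ N) {p : ℤ × ℤ} (hp : p ∈ ringDom N) :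
    ringTile N p ∈ ringTiles := by
  obtain ⟨x, y⟩ := p
  rw [mem_ringDom] at hp
  simp only [ringTile, ringTiles, Finset.mem_insert, Finset.mem_singleton, TileType.mk.injEq]
  grind (splits := 40)

lemma ringNext_mem {N : ℕ} {p : ℤ × ℤ} (hp : p ∈ ringDom N) : ringNext N p ∈ ringDom N := by
  obtain ⟨x, y⟩ := p
  rw [mem_ringDom] at hp
  simp only [ringNext]
  split_ifs <;> rw [mem_ringDom] <;> omega

lemma ringNext_injOn {N : ℕ} {p q : ℤ × ℤ} (hp : p ∈ ringDom N) (hq : q ∈ ringDom N)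
    (h : ringNext N p = ringNext N q) : p = q := by
  obtain ⟨x, y⟩ := p
  obtain ⟨x', y'⟩ := q
  rw [mem_ringDom] at hp hq
  simp only [ringNext] at h
  split_ifs at h <;> simp only [Prod.mk.injEq] at h ⊢ <;> omega

lemma ringNext_ne {N : ℕ} {p : ℤ × ℤ} : ringNext N p ≠ p := by
  obtain ⟨x, y⟩ := p
  simp only [ringNext]
  split_ifs <;> simp only [ne_eq, Prod.mk.injEq] <;> omega

lemma ringNext_ringNext_ne {N : ℕ} (hN : 1 ≤ N) {p : ℤ × ℤ} (hp : p ∈ ringDom N) :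
    ringNext N (ringNext N p) ≠ p := by
  obtain ⟨x, y⟩ := p
  rw [mem_ringDom] at hp
  simp only [ringNext]
  split_ifs <;> simp only [ne_eq, Prod.mk.injEq] at * <;> omega

/-- A nonempty set of positions of the ring closed under successors is everything. -/
lemma ringDom_subset_of_closed {N : ℕ} {S : Set (ℤ × ℤ)} {p : ℤ × ℤ} (hpS : p ∈ S)
    (hp : p ∈ ringDom N) (hS : ∀ q ∈ ringDom N, q ∈ S → ringNext N q ∈ S) :
    ∀ q ∈ ringDom N, q ∈ S := by
  have bottom : ∀ k : ℕ, ∀ x : ℤ, (x, 0) ∈ S → 0 ≤ x → x + k ≤ N → (x + k, 0) ∈ S := by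
    intro k x hx h0
    induction k with
    | zero => simp [hx]
    | succ k ih =>
      intro hk
      push_cast at hk
      have h := hS _ (mem_ringDom.2 (by omega)) (ih (by omega))
      rw [ringNext, if_pos rfl, if_pos (show x + (k : ℤ) < N by omega)] at h
      simpa [add_assoc] using h
  have top : ∀ k : ℕ, ∀ x : ℤ, (x, 1) ∈ S → x ≤ N → 0 ≤ x - k → (x - k, 1) ∈ S := by
    intro k x hx h0
    induction k with
    | zero => simp [hx]
    | succ k ih =>
      intro hk
      push_cast at hk
      have h := hS _ (mem_ringDom.2 (by omega)) (ih (by omega))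
      rw [ringNext, if_neg (by simp), if_pos (show 0 < x - (k : ℤ) by omega)] at h
      simpa [sub_sub] using h
  have bottom_le : ∀ x y : ℤ, (x, 0) ∈ S → 0 ≤ x → x ≤ y → y ≤ N → (y, 0) ∈ S := by
    intro x y hx h0 hxy hy
    have h := bottom (y - x).toNat x hx h0 (by omega)
    rwa [Int.toNat_of_nonneg (by omega), add_sub_cancel] at h
  have top_le : ∀ x y : ℤ, (x, 1) ∈ S → x ≤ N → y ≤ x → 0 ≤ y → (y, 1) ∈ S := by
    intro x y hx h0 hxy hy
    have h := top (x - y).toNat x hx h0 (by omega)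
    rwa [Int.toNat_of_nonneg (by omega), sub_sub_cancel] at h
  have right : ((N : ℤ), 0) ∈ S → ((N : ℤ), 1) ∈ S := fun h => by
    simpa [ringNext] using hS _ (mem_ringDom.2 (by omega)) h
  have left : ((0 : ℤ), 1) ∈ S → ((0 : ℤ), 0) ∈ S := fun h => by
    simpa [ringNext] using hS _ (mem_ringDom.2 (by omega)) h
  have origin : ((0 : ℤ), 0) ∈ S := by
    obtain ⟨x, y⟩ := p
    rw [mem_ringDom] at hp
    obtain rfl | rfl : y = 0 ∨ y = 1 := by omega
    · exact left (top_le N 0 (right (bottom_le x N hpS (by omega) (by omega) le_rfl)) le_rfl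
        (by omega) le_rfl)
    · exact left (top_le x 0 hpS (by omega) (by omega) le_rfl)
  rintro ⟨x, y⟩ hq
  rw [mem_ringDom] at hq
  obtain rfl | rfl : y = 0 ∨ y = 1 := by omega
  · exact bottom_le 0 x origin le_rfl (by omega) (by omega)
  · exact top_le N x (right (bottom_le 0 N origin le_rfl (by omega) le_rfl)) le_rfl
      (by omega) (by omega)

/-- If the ring is split in two parts, some successor step leads from the first to the second. -/
lemma exists_ringNext_mem {N : ℕ} {A B : Finset (ℤ × ℤ)} (h : A ∪ B = ringDom N)
    (hd : Disjoint A B) (hA : A.Nonempty) (hB : B.Nonempty) :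
    ∃ p ∈ A, ringNext N p ∈ B := by
  by_contra! hc
  obtain ⟨p, hp⟩ := hA
  obtain ⟨q, hq⟩ := hB
  have closed : ∀ r ∈ ringDom N, r ∈ (A : Set (ℤ × ℤ)) → ringNext N r ∈ (A : Set (ℤ × ℤ)) := by
    intro r hr hrA
    have hn := ringNext_mem hr
    rw [← h, Finset.mem_union] at hn
    exact hn.resolve_right (hc r hrA)
  have hqA := ringDom_subset_of_closed (Finset.mem_coe.2 hp)
    (h ▸ Finset.mem_union_left _ hp) closed q (h ▸ Finset.mem_union_right _ hq)
  exact Finset.disjoint_left.1 hd hqA hq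

lemma interactionStrength_ring {N : ℕ} {p q : ℤ × ℤ} (hp : p ∈ ringDom N) (hq : q ∈ ringDom N)
    (h : q = ringNext N p ∨ p = ringNext N q) :
    interactionStrength unitStrength (ring N) p q = 1 := by
  obtain ⟨x, y⟩ := p
  obtain ⟨x', y'⟩ := q
  simp only [interactionStrength, ring, if_pos hp, if_pos hq, ringTile, ringNext, unitStrength] at *
  rw [mem_ringDom] at hp hq
  simp only [Prod.mk.injEq]
  grind (splits := 40)

lemma interactionStrength_ring_eq_zero {N : ℕ} {p q : ℤ × ℤ}
    (h₁ : q ≠ ringNext N p) (h₂ : p ≠ ringNext N q) :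
    interactionStrength unitStrength (ring N) p q = 0 := by
  by_cases hp : p ∈ ringDom N
  swap
  · simp [interactionStrength, ring, hp]
  by_cases hq : q ∈ ringDom N
  swap
  · simp [interactionStrength, ring, hq]
  obtain ⟨x, y⟩ := p
  obtain ⟨x', y'⟩ := q
  simp only [interactionStrength, ring, if_pos hp, if_pos hq, ringTile, ringNext, unitStrength] at *
  rw [mem_ringDom] at hp hq
  simp only [Prod.mk.injEq]
  grind (splits := 40)

lemma interactionStrength_le_one {str : ℕ → ℕ} (hstr : ∀ g, str g ≤ 1) (α : Assembly)
    (p q : ℤ × ℤ) : interactionStrength str α p q ≤ 1 := by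
  unfold interactionStrength
  split
  · split_ifs <;> first | exact hstr _ | exact zero_le_one
  · exact zero_le_one

lemma interactionStrength_unplace_le (str : ℕ → ℕ) (α : Assembly) (r p q : ℤ × ℤ) :
    interactionStrength str (unplace α r) p q ≤ interactionStrength str α p q := by
  by_cases hp : p = r
  · simp [interactionStrength, unplace, hp]
  by_cases hq : q = r
  · simp [interactionStrength, unplace, hq]
  simp [interactionStrength, unplace, hp, hq]

lemma isStable_ring {N : ℕ} (hN : 1 ≤ N) : IsStable unitStrength 2 (ring N) := by
  intro A B h hd hA hB
  rw [adom_ring] at h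
  have hu : A ∪ B = ringDom N := Finset.coe_injective ((Finset.coe_union A B).trans h)
  obtain ⟨p, hp, hp'⟩ := exists_ringNext_mem hu hd hA hB
  obtain ⟨q, hq, hq'⟩ := exists_ringNext_mem (Finset.union_comm A B ▸ hu) hd.symm hB hA
  have hAd : ∀ r ∈ A, r ∈ ringDom N := fun r hr => hu ▸ Finset.mem_union_left _ hr
  have hBd : ∀ r ∈ B, r ∈ ringDom N := fun r hr => hu ▸ Finset.mem_union_right _ hr
  have hne : (p, ringNext N p) ≠ (ringNext N q, q) := by
    intro he
    obtain ⟨h₁, h₂⟩ := Prod.mk.inj he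
    exact ringNext_ringNext_ne hN (hBd q hq) (h₁ ▸ h₂)
  rw [cutStrength, ← Finset.sum_product']
  calc 2 = ∑ z ∈ {(p, ringNext N p), (ringNext N q, q)},
        interactionStrength unitStrength (ring N) z.1 z.2 := by
        rw [Finset.sum_pair hne,
          interactionStrength_ring (hAd p hp) (hBd _ hp') (Or.inl rfl),
          interactionStrength_ring (hAd _ hq') (hBd q hq) (Or.inr rfl)]
    _ ≤ _ := by
        refine Finset.sum_le_sum_of_subset ?_
        intro z hz
        simp only [Finset.mem_insert, Finset.mem_singleton] at hz
        rcases hz with rfl | rfl <;> simp [*]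

lemma adom_unplace (α : Assembly) (p : ℤ × ℤ) : adom (unplace α p) = adom α \ {p} := by
  ext q
  by_cases h : q = p <;> simp [adom, unplace, h]

lemma not_isStable_unplace_ring {N : ℕ} (hN : 1 ≤ N) {p : ℤ × ℤ} (hp : p ∈ ringDom N) :
    ¬ IsStable unitStrength 2 (unplace (ring N) p) := by
  intro h
  have hn := ringNext_mem hp
  have hnn := ringNext_mem hn
  have key := h {ringNext N p} (((ringDom N).erase p).erase (ringNext N p)) ?_ ?_ ?_ ?_
  · rw [cutStrength, Finset.sum_singleton] at key
    have hle : ∑ q ∈ ((ringDom N).erase p).erase (ringNext N p),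
        interactionStrength unitStrength (unplace (ring N) p) (ringNext N p) q ≤
        ∑ q ∈ {ringNext N (ringNext N p)},
          interactionStrength unitStrength (unplace (ring N) p) (ringNext N p) q := by
      refine Finset.sum_le_sum_of_ne_zero fun q hq hne => ?_
      simp only [Finset.mem_erase] at hq
      rw [Finset.mem_singleton]
      by_contra hq'
      refine hne (Nat.le_zero.1 ((interactionStrength_unplace_le _ _ _ _ _).trans_eq
        (interactionStrength_ring_eq_zero hq' fun he => hq.2.1 ?_)))
      exact (ringNext_injOn hp hq.2.2 he).symm
    rw [Finset.sum_singleton] at hle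
    have := interactionStrength_le_one unitStrength_le_one (unplace (ring N) p) (ringNext N p)
      (ringNext N (ringNext N p))
    omega
  · rw [adom_unplace, adom_ring, ← Finset.coe_union, ← Finset.insert_eq,
      Finset.insert_erase (Finset.mem_erase.2 ⟨ringNext_ne, hn⟩), Finset.coe_erase]
  · simp
  · simp
  · exact ⟨ringNext N (ringNext N p), by simp [ringNext_ne, ringNext_ringNext_ne hN hp, hnn]⟩

/-- With glues of strength at most 1, nothing attaches with strength 2 to a single tile. -/
lemma attachStrength_le_one {str : ℕ → ℕ} (hstr : ∀ g, str g ≤ 1) {σ : Assembly} {p : ℤ × ℤ}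
    (hσ : ∀ q, q ≠ p → σ q = none) (q : ℤ × ℤ) (t : TileType) :
    attachStrength str σ q t ≤ 1 := by
  have bond : ∀ (r : ℤ × ℤ) (g : ℕ) (side : TileType → ℕ),
      (match σ r with
        | some u => if g = side u then str g else 0
        | none => 0) ≤ if r = p then 1 else 0 := by
    intro r g side
    by_cases hr : r = p
    · rw [if_pos hr]
      split
      · split_ifs
        · exact hstr g
        · exact zero_le_one
      · exact zero_le_one
    · simp [hσ r hr, hr]
  have hN := bond (q.1, q.2 + 1) t.north TileType.south
  have hE := bond (q.1 + 1, q.2) t.east TileType.west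
  have hS := bond (q.1, q.2 - 1) t.south TileType.north
  have hW := bond (q.1 - 1, q.2) t.west TileType.east
  refine (add_le_add (add_le_add (add_le_add hN hE) hS) hW).trans ?_
  obtain ⟨x, y⟩ := p
  simp only [Prod.mk.injEq]
  split_ifs <;> omega

/-- With glues of strength at most 1, an assembly that loses stability on the removal of any
tile is not producible at temperature 2 from a single tile. -/
lemma not_producible_of_not_isStable_unplace {tiles : Finset TileType} {str : ℕ → ℕ}
    (hstr : ∀ g, str g ≤ 1) {α σ : Assembly}
    (hα : ∀ p, α p ≠ none → ¬ IsStable str 2 (unplace α p)) (hσ : (adom σ).ncard = 1) :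
    ¬ Producible ⟨tiles, str, σ, 2⟩ α := by
  rintro ⟨f, ⟨h0, hf⟩, hlim⟩
  obtain ⟨p, hp⟩ := Set.ncard_eq_one.1 hσ
  have hnone : ∀ q, q ≠ p → σ q = none := fun q hq => by
    by_contra hc
    exact hq (hp ▸ (show q ∈ adom σ from hc) : q ∈ ({p} : Set (ℤ × ℤ)))
  have hconst : ∀ n, f n = σ := by
    intro n
    induction n with
    | zero => exact h0
    | succ n ih =>
      rcases hf n with ⟨q, t, -, -, hs, -⟩ | h
      · rw [ih] at hs
        exact absurd (hs.trans (attachStrength_le_one hstr hnone q t)) (by simp)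
      · rw [h, ih]
  have hασ : α = σ := by
    ext q t
    simp [hlim, hconst]
  subst hασ
  have hpα : p ∈ adom α := hp ▸ Set.mem_singleton p
  refine hα p hpα fun A B hAB _ ⟨a, ha⟩ _ => ?_
  have haE : a ∈ adom (unplace α p) := hAB ▸ Or.inl ha
  rw [adom_unplace, hp] at haE
  exact absurd haE.1 haE.2

lemma ring_injective : Function.Injective ring := by
  intro M N h
  have hd : ringDom M = ringDom N := by
    have := congrArg adom h
    rw [adom_ring, adom_ring] at this
    exact_mod_cast this
  have h₁ : ((M : ℤ), (0 : ℤ)) ∈ ringDom N := hd ▸ mem_ringDom.2 (by omega)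
  have h₂ : ((N : ℤ), (0 : ℤ)) ∈ ringDom M := hd ▸ mem_ringDom.2 (by omega)
  rw [mem_ringDom] at h₁ h₂
  omega

/-- **Garden of Eden assemblies**: there is a finite tile set with glue
strengths in `{0,1}` admitting infinitely many finite assemblies that are
2-stable but become unstable upon the removal of any single tile; consequently
no such assembly can arise from a valid growth process at temperature 2
starting from a single-tile seed. -/
theorem garden_of_eden :
    ∃ tiles : Finset TileType, ∃ str : ℕ → ℕ, str 0 = 0 ∧ (∀ g, str g ≤ 1) ∧
      {α : Assembly | (adom α).Finite ∧ (∀ p t, α p = some t → t ∈ tiles) ∧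
        IsStable str 2 α ∧
        (∀ p, α p ≠ none → ¬ IsStable str 2 (unplace α p)) ∧
        (∀ σ : Assembly, (adom σ).ncard = 1 → (∀ p t, σ p = some t → t ∈ tiles) →
          ¬ Producible ⟨tiles, str, σ, 2⟩ α)}.Infinite := by
  refine ⟨ringTiles, unitStrength, rfl, unitStrength_le_one,
    Set.infinite_of_injective_forall_mem (f := fun n => ring (n + 1))
      (ring_injective.comp (add_left_injective 1)) fun n => ?_⟩
  have hN : 1 ≤ n + 1 := n.succ_pos
  have hremove : ∀ p, ring (n + 1) p ≠ none →
      ¬ IsStable unitStrength 2 (unplace (ring (n + 1)) p) := fun p hp =>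
    not_isStable_unplace_ring hN (by
      rw [← Finset.mem_coe, ← adom_ring]
      exact hp)
  refine ⟨?_, ?_, isStable_ring hN, hremove, fun σ hσ _ =>
    not_producible_of_not_isStable_unplace unitStrength_le_one hremove hσ⟩
  · rw [adom_ring]
    exact Finset.finite_toSet _
  · intro p t hpt
    simp only [ring, Option.ite_none_right_eq_some, Option.some.injEq] at hpt
    exact hpt.2 ▸ ringTile_mem_ringTiles hN hpt.1

end ATAM
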